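/- For every finite simple graph G = (V,E), Σ_{v ∈ V'} √(3·l(v) + d(v)) ≤ Σ_{v ∈ V} √(d(v)); in particular, the bound 2·e₁₁ + Σ_{v ∈ V'} √(3·l(v) + d(v)) on the energy is at most Σ_{v ∈ V} √(d(v)). -/

import Mathlib

open Finset

namespace GraphEnergy

variable {V : Type*} [Fintype V] [DecidableEq V]

/-- The adjacency matrix of a simple graph over `ℝ` is Hermitian. -/
theorem adjMatrix_isHermitian (G : SimpleGraph V) [DecidableRel G.Adj] :
    (G.adjMatrix ℝ).IsHermitian := by
  ext i j
  simp [Matrix.conjTranspose_apply, SimpleGraph.adj_comm]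

/-- The energy of a finite simple graph: the sum of the absolute values of the
eigenvalues of its adjacency matrix. -/
noncomputable def energy (G : SimpleGraph V) [DecidableRel G.Adj] : ℝ :=
  ∑ i, |(adjMatrix_isHermitian G).eigenvalues i|

/-- The set of inner vertices: vertices of degree at least 2. -/
def innerVerts (G : SimpleGraph V) [DecidableRel G.Adj] : Finset V :=
  univ.filter (fun v => 2 ≤ G.degree v)

/-- The set of leaves: vertices of degree 1. -/
def leaves (G : SimpleGraph V) [DecidableRel G.Adj] : Finset V :=
  univ.filter (fun v => G.degree v = 1)

/-- The number of neighbors of `v` that are leaves. -/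
def leafCount (G : SimpleGraph V) [DecidableRel G.Adj] (v : V) : ℕ :=
  ((G.neighborFinset v).filter (fun w => G.degree w = 1)).card

open scoped Classical in
/-- The number of edges both of whose endpoints are leaves. -/
noncomputable def e11 (G : SimpleGraph V) [DecidableRel G.Adj] : ℕ :=
  (G.edgeFinset.filter (fun e => ∀ v ∈ e, G.degree v = 1)).card

theorem sqrt_three_mul_add_le (l d : ℕ) (hd : 1 ≤ d) :
    √(3 * (l : ℝ) + d) ≤ √(d : ℝ) + l := by
  have hs : (1 : ℝ) ≤ √(d : ℝ) := Real.one_le_sqrt.mpr (by exact_mod_cast hd)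
  have hsq : √(d : ℝ) ^ 2 = d := Real.sq_sqrt d.cast_nonneg
  have hl : (l : ℝ) ≤ (l : ℝ) ^ 2 := by exact_mod_cast Nat.le_self_pow two_ne_zero l
  have hmul : (l : ℝ) ≤ l * √(d : ℝ) := le_mul_of_one_le_right l.cast_nonneg hs
  apply Real.sqrt_le_iff.mpr
  constructor
  · positivity
  · nlinarith

/-- Each leaf is counted exactly once, by its unique neighbor. -/
theorem sum_leafCount (G : SimpleGraph V) [DecidableRel G.Adj] :
    ∑ v, leafCount G v = (leaves G).card := by
  have h := sum_card_bipartiteAbove_eq_sum_card_bipartiteBelow (s := univ) (t := leaves G) G.Adj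
  have habove (v : V) : (leaves G).bipartiteAbove G.Adj v =
      (G.neighborFinset v).filter (fun w => G.degree w = 1) := by
    ext w
    simp [bipartiteAbove, leaves, and_comm]
  have hbelow (w : V) : univ.bipartiteBelow G.Adj w = G.neighborFinset w := by
    ext v
    simp [bipartiteBelow, G.adj_comm]
  simp only [habove, hbelow, SimpleGraph.card_neighborFinset_eq_degree] at h
  simp only [leafCount, h]
  rw [card_eq_sum_ones]
  exact sum_congr rfl fun w hw => by simpa [leaves] using hw

/-- The graph formed by the edges of `G` between two leaves. -/
def leafGraph (G : SimpleGraph V) [DecidableRel G.Adj] : SimpleGraph V where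
  Adj v w := G.Adj v w ∧ G.degree v = 1 ∧ G.degree w = 1
  symm := ⟨fun _ _ h => ⟨h.1.symm, h.2.2, h.2.1⟩⟩
  loopless := ⟨fun _ h => G.irrefl h.1⟩

theorem leafGraph_adj (G : SimpleGraph V) [DecidableRel G.Adj] (v w : V) :
    (leafGraph G).Adj v w ↔ G.Adj v w ∧ G.degree v = 1 ∧ G.degree w = 1 :=
  Iff.rfl

open scoped Classical in
theorem two_mul_e11 (G : SimpleGraph V) [DecidableRel G.Adj] :
    2 * e11 G = ∑ v ∈ leaves G, leafCount G v := by
  have hedge : (leafGraph G).edgeFinset =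
      G.edgeFinset.filter (fun e => ∀ v ∈ e, G.degree v = 1) := by
    ext e
    induction e with
    | _ v w => simp [leafGraph_adj]
  have hdeg (v : V) : (leafGraph G).degree v =
      if G.degree v = 1 then leafCount G v else 0 := by
    rw [← SimpleGraph.card_neighborFinset_eq_degree]
    split_ifs with hv
    · unfold leafCount
      congr 1
      ext w
      simp [leafGraph_adj, hv]
    · rw [card_eq_zero]
      ext w
      simp [leafGraph_adj, hv]
  rw [e11, ← hedge, ← SimpleGraph.sum_degrees_eq_twice_card_edges, leaves, sum_filter]
  exact sum_congr rfl fun v _ => hdeg v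

theorem disjoint_leaves_innerVerts (G : SimpleGraph V) [DecidableRel G.Adj] :
    Disjoint (leaves G) (innerVerts G) := by
  refine disjoint_filter.mpr fun v _ h₁ h₂ => ?_
  omega

theorem two_mul_e11_add_sum_leafCount_le (G : SimpleGraph V) [DecidableRel G.Adj] :
    2 * e11 G + ∑ v ∈ innerVerts G, leafCount G v ≤ (leaves G).card := by
  rw [two_mul_e11, ← sum_union (disjoint_leaves_innerVerts G), ← sum_leafCount]
  exact sum_le_sum_of_subset (subset_univ _)

theorem card_leaves_add_sum_sqrt_le (G : SimpleGraph V) [DecidableRel G.Adj] :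
    ((leaves G).card : ℝ) + ∑ v ∈ innerVerts G, √(G.degree v : ℝ) ≤
      ∑ v, √(G.degree v : ℝ) := by
  have hleaf : ∑ v ∈ leaves G, √(G.degree v : ℝ) = (leaves G).card := by
    rw [card_eq_sum_ones, Nat.cast_sum]
    refine sum_congr rfl fun v hv => ?_
    have hv' : G.degree v = 1 := by simpa [leaves] using hv
    simp [hv']
  rw [← hleaf, ← sum_union (disjoint_leaves_innerVerts G)]
  exact sum_le_sum_of_subset_of_nonneg (subset_univ _) fun v _ _ => Real.sqrt_nonneg _

/-- The bound `∑_{v ∈ V'} √(3 l(v) + d(v))` is at most `∑_{v ∈ V} √(d(v))`; in particular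
`2 e₁₁ + ∑_{v ∈ V'} √(3 l(v) + d(v)) ≤ ∑_{v ∈ V} √(d(v))`. -/
theorem sum_inner_sqrt_le_sum_sqrt_degree (G : SimpleGraph V) [DecidableRel G.Adj] :
    (∑ v ∈ innerVerts G, Real.sqrt (3 * (leafCount G v : ℝ) + (G.degree v : ℝ)) ≤
      ∑ v : V, Real.sqrt (G.degree v : ℝ)) ∧
    2 * (e11 G : ℝ) +
        ∑ v ∈ innerVerts G, Real.sqrt (3 * (leafCount G v : ℝ) + (G.degree v : ℝ)) ≤
      ∑ v : V, Real.sqrt (G.degree v : ℝ) := by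
  have hinner : ∑ v ∈ innerVerts G, √(3 * (leafCount G v : ℝ) + (G.degree v : ℝ)) ≤
      ∑ v ∈ innerVerts G, √(G.degree v : ℝ) + ∑ v ∈ innerVerts G, (leafCount G v : ℝ) := by
    rw [← sum_add_distrib]
    refine sum_le_sum fun v hv => sqrt_three_mul_add_le _ _ ?_
    have hv' : 2 ≤ G.degree v := by simpa [innerVerts] using hv
    omega
  have hcount : 2 * (e11 G : ℝ) + ∑ v ∈ innerVerts G, (leafCount G v : ℝ) ≤ (leaves G).card := by
    exact_mod_cast two_mul_e11_add_sum_leafCount_le G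
  have hsum := card_leaves_add_sum_sqrt_le G
  have he : (0 : ℝ) ≤ e11 G := Nat.cast_nonneg _
  constructor <;> linarith

end GraphEnergy
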